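/- Fix an integer d ≥ 1, T > 0, β ∈ (1/3, 1], a measurable bounded function a : [0,T] → ℝ, and a smooth probability density Φ on ℝ^d with compact support. Define F(t,x) := a(t)|x|^β and its mollification F^{(ε)}(t,x) := ∫_{ℝ^d} Φ_ε(x − y) F(t,y) dy. Then for every λ > 0 there exists a nonnegative function g ∈ L¹([0,T]) such that for all 0 ≤ t < s ≤ T, all θ ∈ ℝ^d and all ε > 0, ∫_{ℝ^d} |∇_y F^{(ε)}(s,y)| Γ(λ(s−t)³, y − θ) dy ≤ g(s−t). In fact one may take g(r) = C r^{(3/2)(β−1)} for a constant C > 0 depending only on d, β, λ, sup_t|a(t)| and Φ. -/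

import Mathlib

open MeasureTheory

noncomputable section

/-- The `d`-dimensional Gaussian density `Γ(t,x) = (2πt)^{−d/2} exp(−|x|²/(2t))`. -/
def gaussΓ (d : ℕ) (t : ℝ) (x : EuclideanSpace ℝ (Fin d)) : ℝ :=
  (2 * Real.pi * t) ^ (-(d : ℝ) / 2) * Real.exp (-‖x‖ ^ 2 / (2 * t))

/-- The mollification `F^{(ε)}(t,x) = ∫ Φ_ε(x−y) F(t,y) dy` of `F(t,y) = a(t)|y|^β`,
with `Φ_ε(y) = ε^{−d} Φ(y/ε)`. -/
def mollPeano (d : ℕ) (Φ : EuclideanSpace ℝ (Fin d) → ℝ) (a : ℝ → ℝ) (β ε t : ℝ)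
    (x : EuclideanSpace ℝ (Fin d)) : ℝ :=
  ∫ y : EuclideanSpace ℝ (Fin d), (ε ^ (-(d : ℝ)) * Φ (ε⁻¹ • (x - y))) * (a t * ‖y‖ ^ β)

lemma aux_rpow {p q b : ℝ} (hb0 : 0 < b) (hb1 : b ≤ 1) (hp : 0 ≤ p) (hq : 0 < q) :
    |p ^ b - q ^ b| ≤ |p - q| * q ^ (b - 1) := by
  have key : ∀ x y : ℝ, 0 ≤ x → 0 < y → x ≤ y → y ^ b - x ^ b ≤ (y - x) * y ^ (b - 1) := by
    intro x y hx hy hxy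
    have h1 : x / y ≤ (x / y) ^ b := by
      have h0 : 0 ≤ x / y := by positivity
      have h2 : x / y ≤ 1 := (div_le_one hy).2 hxy
      exact Real.self_le_rpow_of_le_one h0 h2 hb1
    rw [Real.div_rpow hx hy.le, div_le_div_iff₀ hy (by positivity)] at h1
    rw [Real.rpow_sub_one hy.ne']
    have : (y - x) * (y ^ b / y) = y ^ b - x * y ^ b / y := by field_simp
    rw [this]
    have : x * y ^ b / y ≤ x ^ b := (div_le_iff₀ hy).2 h1
    linarith
  rcases le_total p q with h | h
  · rw [abs_sub_comm, abs_sub_comm p q, abs_of_nonneg (sub_nonneg.2 h),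
      abs_of_nonneg (sub_nonneg.2 (Real.rpow_le_rpow hp h hb0.le))]
    exact key p q hp hq h
  · rw [abs_of_nonneg (sub_nonneg.2 h),
      abs_of_nonneg (sub_nonneg.2 (Real.rpow_le_rpow hq.le h hb0.le))]
    refine (key q p hq.le (hq.trans_le h) h).trans ?_
    exact mul_le_mul_of_nonneg_left
      (Real.rpow_le_rpow_of_nonpos hq h (by linarith)) (sub_nonneg.2 h)

lemma gauss_nonneg (d : ℕ) {t : ℝ} (ht : 0 < t) (x : EuclideanSpace ℝ (Fin d)) :
    0 ≤ gaussΓ d t x := by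
  unfold gaussΓ; positivity

lemma gauss_le (d : ℕ) {t : ℝ} (ht : 0 < t) (x : EuclideanSpace ℝ (Fin d)) :
    gaussΓ d t x ≤ (2 * Real.pi * t) ^ (-(d : ℝ) / 2) := by
  unfold gaussΓ
  have : Real.exp (-‖x‖ ^ 2 / (2 * t)) ≤ 1 := by
    rw [Real.exp_le_one_iff]
    exact div_nonpos_of_nonpos_of_nonneg (by simp) (by positivity)
  exact mul_le_of_le_one_right (by positivity) this

lemma gauss_integral (d : ℕ) {t : ℝ} (ht : 0 < t) :
    ∫ x, gaussΓ d t x = 1 := by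
  unfold gaussΓ
  rw [integral_const_mul]
  have h : ∀ x : EuclideanSpace ℝ (Fin d), Real.exp (-‖x‖ ^ 2 / (2 * t))
      = Real.exp (-(1 / (2 * t)) * ‖x‖ ^ 2) := fun x => by congr 1; ring
  simp_rw [h]
  rw [GaussianFourier.integral_rexp_neg_mul_sq_norm (by positivity)]
  have : Real.pi / (1 / (2 * t)) = 2 * Real.pi * t := by field_simp
  rw [this, finrank_euclideanSpace_fin, ← Real.rpow_add (by positivity)]
  simp [neg_div]

lemma gauss_integrable (d : ℕ) {t : ℝ} (ht : 0 < t) : Integrable (gaussΓ d t) := by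
  by_contra h
  have := integral_undef h
  rw [gauss_integral d ht] at this
  norm_num at this

lemma gauss_continuous (d : ℕ) (t : ℝ) : Continuous (gaussΓ d t) := by
  unfold gaussΓ; fun_prop

lemma ball_integrable (d : ℕ) (hd : 1 ≤ d) {p : ℝ} (hp : -1 < p) (R : ℝ) :
    IntegrableOn (fun x : EuclideanSpace ℝ (Fin d) => ‖x‖ ^ p) (Metric.ball 0 R) := by
  haveI : Nonempty (Fin d) := ⟨⟨0, hd⟩⟩
  rw [integrableOn_fun_norm_addHaar volume (f := fun r : ℝ => r ^ p)]
  rcases le_or_gt R 0 with hR | hR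
  · simp [Set.Ioo_eq_empty (not_lt.2 hR)]
  have h1 : IntegrableOn (fun y : ℝ => y ^ ((d : ℝ) - 1 + p)) (Set.Ioo 0 R) := by
    rw [intervalIntegral.integrableOn_Ioo_rpow_iff hR]
    have : (1 : ℝ) ≤ d := by exact_mod_cast hd
    linarith
  refine h1.congr_fun ?_ measurableSet_Ioo
  intro y hy
  simp only [finrank_euclideanSpace_fin, smul_eq_mul]
  rw [Real.rpow_add hy.1, ← Real.rpow_natCast, Nat.cast_sub hd]
  simp

lemma ball_scale (d : ℕ) (p : ℝ) {R : ℝ} (hR : 0 < R) :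
    ∫ x in Metric.ball (0 : EuclideanSpace ℝ (Fin d)) R, ‖x‖ ^ p =
      R ^ ((d : ℝ) + p) * ∫ x in Metric.ball (0 : EuclideanSpace ℝ (Fin d)) 1, ‖x‖ ^ p := by
  have h := Measure.setIntegral_comp_smul (volume : Measure (EuclideanSpace ℝ (Fin d)))
    (fun x => ‖x‖ ^ p) (Metric.ball 0 1) hR.ne'
  rw [smul_unitBall_of_pos hR] at h
  simp only [norm_smul, Real.norm_eq_abs, abs_of_pos hR, finrank_euclideanSpace_fin,
    smul_eq_mul] at h
  simp_rw [Real.mul_rpow hR.le (norm_nonneg _)] at h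
  rw [integral_const_mul, abs_of_pos (by positivity)] at h
  rw [Real.rpow_add hR, Real.rpow_natCast, mul_assoc, h]
  field_simp

lemma sup_bound (d : ℕ) (hd : 1 ≤ d) {p : ℝ} (hp : -1 < p) (hp0 : p ≤ 0) :
    ∃ M : ℝ, 0 < M ∧ ∀ τ : ℝ, 0 < τ → ∀ θ : EuclideanSpace ℝ (Fin d),
      ∫⁻ y : EuclideanSpace ℝ (Fin d), ENNReal.ofReal (‖y‖ ^ p * gaussΓ d τ (y - θ)) ≤
        ENNReal.ofReal (M * τ ^ (p / 2)) := by
  set I := ∫ x in Metric.ball (0 : EuclideanSpace ℝ (Fin d)) 1, ‖x‖ ^ p with hI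
  have hI0 : 0 ≤ I := integral_nonneg fun x => by positivity
  refine ⟨1 + (2 * Real.pi) ^ (-(d : ℝ) / 2) * I, by positivity, ?_⟩
  intro τ hτ θ
  set c := (2 * Real.pi * τ) ^ (-(d : ℝ) / 2) with hc
  have hc0 : 0 ≤ c := by positivity
  set b := Metric.ball (0 : EuclideanSpace ℝ (Fin d)) (√τ) with hb
  have hs : 0 < √τ := Real.sqrt_pos.2 hτ
  have hsp : (√τ) ^ p = τ ^ (p / 2) := by
    rw [Real.sqrt_eq_rpow, ← Real.rpow_mul hτ.le]; congr 1; ring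
  let G : EuclideanSpace ℝ (Fin d) → ℝ := fun y =>
    τ ^ (p / 2) * gaussΓ d τ (y - θ) + c * b.indicator (fun y => ‖y‖ ^ p) y
  have hi1 : Integrable (fun y => τ ^ (p / 2) * gaussΓ d τ (y - θ)) :=
    ((gauss_integrable d hτ).comp_sub_right θ).const_mul _
  have hi2 : Integrable (fun y => c * b.indicator (fun y => ‖y‖ ^ p) y) :=
    ((integrable_indicator_iff Metric.isOpen_ball.measurableSet).2
      (ball_integrable d hd hp _)).const_mul _
  have hGi : Integrable G := hi1.add hi2
  have hle : ∀ y, ‖y‖ ^ p * gaussΓ d τ (y - θ) ≤ G y := by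
    intro y
    have hg := gauss_nonneg d hτ (y - θ)
    by_cases hy : y ∈ b
    · have h1 : ‖y‖ ^ p * gaussΓ d τ (y - θ) ≤ ‖y‖ ^ p * c :=
        mul_le_mul_of_nonneg_left (gauss_le d hτ _) (by positivity)
      have h2 : 0 ≤ τ ^ (p / 2) * gaussΓ d τ (y - θ) := by positivity
      simp only [G, Set.indicator_of_mem hy]
      linarith
    · simp only [G, Set.indicator_of_notMem hy, mul_zero, add_zero]
      refine mul_le_mul_of_nonneg_right ?_ hg
      rw [← hsp]
      refine Real.rpow_le_rpow_of_nonpos hs ?_ hp0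
      simpa [hb] using hy
  have hG0 : ∀ y, 0 ≤ G y := fun y =>
    le_trans (mul_nonneg (by positivity) (gauss_nonneg d hτ _)) (hle y)
  have hGint : ∫ y, G y = (1 + (2 * Real.pi) ^ (-(d : ℝ) / 2) * I) * τ ^ (p / 2) := by
    simp only [G]
    rw [integral_add hi1 hi2, integral_const_mul, integral_const_mul,
      integral_sub_right_eq_self (gaussΓ d τ) θ, gauss_integral d hτ,
      integral_indicator Metric.isOpen_ball.measurableSet, ball_scale d p hs, ← hI, hc,
      Real.mul_rpow (by positivity) hτ.le, Real.rpow_add hs, hsp]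
    have : τ ^ (-(d : ℝ) / 2) * (√τ) ^ (d : ℝ) = 1 := by
      rw [Real.sqrt_eq_rpow, ← Real.rpow_mul hτ.le, ← Real.rpow_add hτ]
      ring_nf; simp
    linear_combination ((2 * Real.pi) ^ (-(d : ℝ) / 2) * I * τ ^ (p / 2)) * this
  rw [← hGint, ofReal_integral_eq_lintegral_ofReal hGi (Filter.Eventually.of_forall hG0)]
  exact lintegral_mono fun y => ENNReal.ofReal_le_ofReal (hle y)

/-- pointwise gradient bound -/
lemma fderiv_bound (d : ℕ) (hd : 1 ≤ d) {β : ℝ} (hβ0 : 0 < β) (hβ1 : β ≤ 1)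
    (P : EuclideanSpace ℝ (Fin d) → ℝ) (hPc : Continuous P) (hP0 : ∀ x, 0 ≤ P x)
    (hPs : HasCompactSupport P) (c B : ℝ) (hc : |c| ≤ B) (hB : 0 < B)
    (x : EuclideanSpace ℝ (Fin d)) :
    ENNReal.ofReal ‖fderiv ℝ (fun x => ∫ y, P (x - y) * (c * ‖y‖ ^ β)) x‖ ≤
      ENNReal.ofReal B * ∫⁻ w, ENNReal.ofReal (P w * ‖x - w‖ ^ (β - 1)) := by
  haveI : Nonempty (Fin d) := ⟨⟨0, hd⟩⟩
  have hrw : (fun x => ∫ y, P (x - y) * (c * ‖y‖ ^ β)) =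
      fun x => ∫ w, P w * (c * ‖x - w‖ ^ β) := by
    funext x
    rw [← integral_sub_left_eq_self _ volume x]
    simp
  rw [hrw]
  by_cases htop : ∫⁻ w, ENNReal.ofReal (P w * ‖x - w‖ ^ (β - 1)) = ⊤
  · rw [htop, ENNReal.mul_top (by simpa using hB)]
    exact le_top
  have hnn : ∀ w, 0 ≤ P w * ‖x - w‖ ^ (β - 1) := fun w => mul_nonneg (hP0 w) (by positivity)
  have hmeas : Measurable (fun w => P w * ‖x - w‖ ^ (β - 1)) := by
    have := hPc.measurable
    fun_prop
  have hint : Integrable (fun w => P w * ‖x - w‖ ^ (β - 1)) :=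
    (lintegral_ofReal_ne_top_iff_integrable hmeas.aestronglyMeasurable
      (Filter.Eventually.of_forall hnn)).1 htop
  have hint2 : ∀ x, Integrable (fun w => P w * (c * ‖x - w‖ ^ β)) := by
    intro x
    refine Continuous.integrable_of_hasCompactSupport ?_ hPs.mul_right
    refine hPc.mul (continuous_const.mul ?_)
    exact (continuous_const.sub continuous_id).norm.rpow_const fun _ => Or.inr hβ0.le
  rw [← ofReal_integral_eq_lintegral_ofReal hint (Filter.Eventually.of_forall hnn),
    ← ENNReal.ofReal_mul hB.le]
  refine ENNReal.ofReal_le_ofReal ?_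
  refine norm_fderiv_le_of_lip' ℝ (mul_nonneg hB.le (integral_nonneg hnn)) ?_
  refine Filter.Eventually.of_forall fun x' => ?_
  rw [← integral_sub (hint2 x') (hint2 x)]
  have : B * (∫ w, P w * ‖x - w‖ ^ (β - 1)) * ‖x' - x‖ =
      ∫ w, (B * ‖x' - x‖) * (P w * ‖x - w‖ ^ (β - 1)) := by
    rw [integral_const_mul]; ring
  rw [this]
  refine norm_integral_le_of_norm_le (hint.const_mul _) ?_
  have hne : ∀ᵐ w : EuclideanSpace ℝ (Fin d), w ≠ x := by
    simp [ae_iff]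
  filter_upwards [hne] with w hw
  have hpos : 0 < ‖x - w‖ := norm_pos_iff.2 (sub_ne_zero.2 hw.symm)
  have h1 := aux_rpow hβ0 hβ1 (norm_nonneg (x' - w)) hpos
  have h2 : |‖x' - w‖ - ‖x - w‖| ≤ ‖x' - x‖ := by
    have := abs_norm_sub_norm_le (x' - w) (x - w)
    simpa using this
  have h3 : P w * (c * ‖x' - w‖ ^ β) - P w * (c * ‖x - w‖ ^ β) =
      P w * c * (‖x' - w‖ ^ β - ‖x - w‖ ^ β) := by ring
  rw [h3, Real.norm_eq_abs, abs_mul, abs_mul, abs_of_nonneg (hP0 w)]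
  have hq : 0 ≤ ‖x - w‖ ^ (β - 1) := by positivity
  calc P w * |c| * |‖x' - w‖ ^ β - ‖x - w‖ ^ β|
      ≤ P w * B * (‖x' - x‖ * ‖x - w‖ ^ (β - 1)) := by
        have := hP0 w
        gcongr
        exact h1.trans (mul_le_mul_of_nonneg_right h2 hq)
    _ = _ := by ring

/-- **The Peano drift `F(t,x) = a(t)|x|^β`, `β ∈ (1/3,1]`, satisfies Hypothesis [Pea]:**
for every `λ > 0` there is a nonnegative integrable `g` on `(0,T]` — in fact
`g(r) = C r^{(3/2)(β−1)}` — dominating `∫ |∇F^{(ε)}(s,y)| Γ(λ(s−t)³, y−θ) dy`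
uniformly in `θ` and `ε > 0`. -/
theorem statement7 (d : ℕ) (hd : 1 ≤ d) (T : ℝ) (hT : 0 < T)
    (β : ℝ) (hβ : β ∈ Set.Ioc (1 / 3 : ℝ) 1)
    (a : ℝ → ℝ) (hameas : Measurable a) (A : ℝ) (ha : ∀ t, |a t| ≤ A)
    (Φ : EuclideanSpace ℝ (Fin d) → ℝ) (hΦsmooth : ContDiff ℝ (⊤ : ℕ∞) Φ)
    (hΦnonneg : ∀ x, 0 ≤ Φ x) (hΦint : (∫ x, Φ x) = 1) (hΦsupp : HasCompactSupport Φ)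
    (lam : ℝ) (hlam : 0 < lam) :
    ∃ C : ℝ, 0 < C ∧
      IntegrableOn (fun r : ℝ => C * r ^ ((3 / 2) * (β - 1))) (Set.Ioc 0 T) ∧
      ∀ t s : ℝ, 0 ≤ t → t < s → s ≤ T →
        ∀ θ : EuclideanSpace ℝ (Fin d), ∀ ε : ℝ, 0 < ε →
          (∫ y : EuclideanSpace ℝ (Fin d),
              ‖fderiv ℝ (mollPeano d Φ a β ε s) y‖ *
                gaussΓ d (lam * (s - t) ^ 3) (y - θ)) ≤
            C * (s - t) ^ ((3 / 2) * (β - 1)) := by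
  obtain ⟨hβl, hβ1⟩ := hβ
  have hβ0 : 0 < β := by linarith
  obtain ⟨M, hM, hMb⟩ := sup_bound d hd (p := β - 1) (by linarith) (by linarith)
  have hA0 : 0 ≤ A := (abs_nonneg _).trans (ha 0)
  refine ⟨(A + 1) * (M * lam ^ ((β - 1) / 2)), by positivity, ?_, ?_⟩
  · refine Integrable.const_mul ?_ _
    have h := (intervalIntegral.intervalIntegrable_rpow' (a := 0) (b := T)
      (r := (3 / 2) * (β - 1)) (by linarith))
    exact (intervalIntegrable_iff_integrableOn_Ioc_of_le hT.le).1 h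
  intro t s ht hts hsT θ ε hε
  have hr : 0 < s - t := sub_pos.2 hts
  set τ := lam * (s - t) ^ 3 with hτdef
  have hτ : 0 < τ := by positivity
  set P : EuclideanSpace ℝ (Fin d) → ℝ := fun w => ε ^ (-(d : ℝ)) * Φ (ε⁻¹ • w) with hP
  have hPc : Continuous P := by
    have := hΦsmooth.continuous
    fun_prop
  have hP0 : ∀ x, 0 ≤ P x := fun x => mul_nonneg (by positivity) (hΦnonneg _)
  have hPs : HasCompactSupport P :=
    (hΦsupp.comp_smul (inv_ne_zero hε.ne')).mul_left
  have hPint : ∫ x, P x = 1 := by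
    simp only [hP]
    rw [integral_const_mul, Measure.integral_comp_inv_smul_of_nonneg _ _ hε.le, hΦint,
      finrank_euclideanSpace_fin, Real.rpow_neg hε.le, Real.rpow_natCast]
    simp [hε.ne']
  have hPl : ∫⁻ x, ENNReal.ofReal (P x) = 1 := by
    rw [← ofReal_integral_eq_lintegral_ofReal (hPc.integrable_of_hasCompactSupport hPs)
      (Filter.Eventually.of_forall hP0), hPint, ENNReal.ofReal_one]
  have hfd := fderiv_bound d hd hβ0 hβ1 P hPc hP0 hPs (a s) (A + 1)
    ((ha s).trans (by linarith)) (by linarith)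
  change ∀ x, ENNReal.ofReal ‖fderiv ℝ (mollPeano d Φ a β ε s) x‖ ≤ _ at hfd
  have hgm : Measurable (gaussΓ d τ) := (gauss_continuous d τ).measurable
  have hPm := hPc.measurable
  have hmain : ∫⁻ y, ENNReal.ofReal ‖‖fderiv ℝ (mollPeano d Φ a β ε s) y‖ * gaussΓ d τ (y - θ)‖
      ≤ ENNReal.ofReal ((A + 1) * (M * τ ^ ((β - 1) / 2))) := by
    calc ∫⁻ y, ENNReal.ofReal ‖‖fderiv ℝ (mollPeano d Φ a β ε s) y‖ * gaussΓ d τ (y - θ)‖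
        ≤ ∫⁻ y, ENNReal.ofReal (A + 1) * ∫⁻ w, ENNReal.ofReal (P w) *
            ENNReal.ofReal (‖y - w‖ ^ (β - 1) * gaussΓ d τ (y - θ)) := by
          refine lintegral_mono fun y => ?_
          have hg := gauss_nonneg d hτ (y - θ)
          rw [Real.norm_of_nonneg (by positivity), ENNReal.ofReal_mul (norm_nonneg _)]
          refine (mul_le_mul_left (hfd y) _).trans ?_
          rw [mul_assoc, ← lintegral_mul_const _ (by fun_prop)]
          refine le_of_eq ?_
          congr 1
          refine lintegral_congr fun w => ?_
          rw [← ENNReal.ofReal_mul (mul_nonneg (hP0 w) (by positivity)),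
            ← ENNReal.ofReal_mul (hP0 w), mul_assoc]
      _ = ENNReal.ofReal (A + 1) * ∫⁻ w, ENNReal.ofReal (P w) *
            ∫⁻ y, ENNReal.ofReal (‖y - w‖ ^ (β - 1) * gaussΓ d τ (y - θ)) := by
          rw [lintegral_const_mul' _ _ ENNReal.ofReal_ne_top, lintegral_lintegral_swap]
          · congr 1
            refine lintegral_congr fun w => ?_
            rw [lintegral_const_mul' _ _ ENNReal.ofReal_ne_top]
          · refine Measurable.aemeasurable ?_
            unfold Function.uncurry
            fun_prop
      _ ≤ ENNReal.ofReal (A + 1) * ∫⁻ w, ENNReal.ofReal (P w) *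
            ENNReal.ofReal (M * τ ^ ((β - 1) / 2)) := by
          gcongr with w
          rw [← lintegral_add_right_eq_self _ w]
          refine le_trans (le_of_eq ?_) (hMb τ hτ (θ - w))
          refine lintegral_congr fun y => ?_
          rw [add_sub_cancel_right, show y + w - θ = y - (θ - w) by abel]
      _ = _ := by
          rw [lintegral_mul_const' _ _ ENNReal.ofReal_ne_top, hPl, one_mul,
            ← ENNReal.ofReal_mul (by linarith)]
  have h1 := (le_abs_self _).trans (norm_integral_le_lintegral_norm
    (μ := (volume : Measure (EuclideanSpace ℝ (Fin d))))
    (fun y => ‖fderiv ℝ (mollPeano d Φ a β ε s) y‖ * gaussΓ d τ (y - θ)))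
  refine h1.trans ((ENNReal.toReal_le_of_le_ofReal (by positivity) hmain).trans (le_of_eq ?_))
  have h3 : ((s - t) ^ 3) ^ ((β - 1) / 2) = (s - t) ^ ((3 / 2) * (β - 1)) := by
    rw [← Real.rpow_natCast, ← Real.rpow_mul hr.le]
    congr 1
    push_cast
    ring
  rw [hτdef, Real.mul_rpow hlam.le (by positivity), h3]
  ring

end
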